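/- Let f be a transcendental self-map of ℂ*, and let G ⊆ ℂ* be a domain (nonempty open connected set) that is bounded in ℂ* and satisfies G ∩ J(f) ≠ ∅. Then ∂G ∩ I_e(f) ≠ ∅ for every e ∈ {0,∞}^ℕ, where ∂G is the boundary of G in ℂ*; in particular, ∂G ∩ I(f) is uncountable. -/

import Mathlib

open Complex Topology Filter Set Function OnePoint

noncomputable section

/-- The chordal (spherical) distance on the Riemann sphere, restricted to finite points. -/
def chordalDist (z w : ℂ) : ℝ :=
  ‖z - w‖ / Real.sqrt ((1 + ‖z‖ ^ 2) * (1 + ‖w‖ ^ 2))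

/-- A transcendental self-map of `ℂ* = ℂ \ {0}`: a holomorphic self-map of the punctured
plane with essential singularities at `0` and `∞`; equivalently, on `ℂ*` it has the form
`z ^ m * exp (g z + h z⁻¹)` for some `m : ℤ` and nonconstant entire functions `g, h`. -/
def IsTranscendentalSelfMapCStar (f : ℂ → ℂ) : Prop :=
  ∃ (m : ℤ) (g h : ℂ → ℂ),
    Differentiable ℂ g ∧ Differentiable ℂ h ∧
    (¬ ∃ c : ℂ, ∀ z, g z = c) ∧ (¬ ∃ c : ℂ, ∀ z, h z = c) ∧
    ∀ z : ℂ, z ≠ 0 → f z = z ^ m * Complex.exp (g z + h z⁻¹)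

/-- The escaping set `I(f)` of a self-map of the punctured plane: points whose orbit
accumulates only at `0` and `∞`. -/
def escapingSet (f : ℂ → ℂ) : Set ℂ :=
  {z | z ≠ 0 ∧ ∀ ε : ℝ, 0 < ε → ∃ N : ℕ, ∀ n ≥ N,
    ‖f^[n] z‖ < ε ∨ 1 / ε < ‖f^[n] z‖}

/-- The little escaping set `I_e(f)` with essential itinerary `e` (where `true` stands for the
symbol `∞` and `false` for the symbol `0`). -/
def littleEscapingSet (f : ℂ → ℂ) (e : ℕ → Bool) : Set ℂ :=
  {z | z ∈ escapingSet f ∧ ∃ ℓ k : ℕ, ∀ n : ℕ,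
    (1 < ‖f^[n + ℓ] z‖ ↔ e (n + k) = true)}

/-- The immediate little escaping set `Ĩ_e(f)`. -/
def immediateLittleEscapingSet (f : ℂ → ℂ) (e : ℕ → Bool) : Set ℂ :=
  {z | z ∈ escapingSet f ∧ ∃ ℓ : ℕ, ∀ n : ℕ,
    (1 < ‖f^[n + ℓ] z‖ ↔ e (n + ℓ) = true)}

/-- The Fatou set of a self-map of the punctured plane: points of `ℂ*` with a neighbourhood
(inside `ℂ*`) on which the family of iterates is equicontinuous w.r.t. the chordal metric. -/
def FatouSet (f : ℂ → ℂ) : Set ℂ :=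
  {z | z ≠ 0 ∧ ∃ U : Set ℂ, IsOpen U ∧ z ∈ U ∧ (∀ w ∈ U, w ≠ 0) ∧
    ∀ w ∈ U, ∀ ε : ℝ, 0 < ε → ∃ δ : ℝ, 0 < δ ∧ ∀ w' ∈ U,
      chordalDist w w' < δ → ∀ n : ℕ, chordalDist (f^[n] w) (f^[n] w') < ε}

/-- The Julia set `J(f) = ℂ* \ F(f)`. -/
def JuliaSet (f : ℂ → ℂ) : Set ℂ := {z : ℂ | z ≠ 0} \ FatouSet f

/-- A Fatou component: a connected component of the Fatou set. -/
def IsFatouComponent (f : ℂ → ℂ) (U : Set ℂ) : Prop :=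
  ∃ z ∈ FatouSet f, U = connectedComponentIn (FatouSet f) z

/-- A wandering domain: a Fatou component `U` such that the Fatou components containing the
iterated images `fⁿ(U)` are pairwise distinct. -/
def IsWanderingDomain (f : ℂ → ℂ) (U : Set ℂ) : Prop :=
  IsFatouComponent f U ∧ ∃ V : ℕ → Set ℂ, V 0 = U ∧
    (∀ n, IsFatouComponent f (V n)) ∧
    (∀ n, f '' V n ⊆ V (n + 1)) ∧ Function.Injective V

/-- A set is bounded in `ℂ*` if it lies in some closed annulus `{r ≤ |z| ≤ R}`. -/
def BoundedInCStar (X : Set ℂ) : Prop :=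
  ∃ r R : ℝ, 0 < r ∧ r ≤ R ∧ X ⊆ {z : ℂ | r ≤ ‖z‖ ∧ ‖z‖ ≤ R}

/-- The boundary of a subset of `ℂ*` taken in `ℂ*`. -/
def boundaryInCStar (G : Set ℂ) : Set ℂ := frontier G \ {0}

/-- The set `I(f) ∪ {0, ∞}` regarded as a subset of the Riemann sphere `ℂ̂ = ℂ ∪ {∞}`. -/
def escapingSphere (f : ℂ → ℂ) : Set (OnePoint ℂ) :=
  ((fun z : ℂ => (z : OnePoint ℂ)) '' escapingSet f) ∪ {((0 : ℂ) : OnePoint ℂ), ∞}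

/-- The set `I_e(f) ∪ {0, ∞}` regarded as a subset of the Riemann sphere. -/
def littleEscapingSphere (f : ℂ → ℂ) (e : ℕ → Bool) : Set (OnePoint ℂ) :=
  ((fun z : ℂ => (z : OnePoint ℂ)) '' littleEscapingSet f e) ∪ {((0 : ℂ) : OnePoint ℂ), ∞}

/-- A subset of the sphere has exactly two connected components. -/
def HasExactlyTwoComponents (K : Set (OnePoint ℂ)) : Prop :=
  ∃ x ∈ K, ∃ y ∈ K, connectedComponentIn K x ≠ connectedComponentIn K y ∧
    ∀ z ∈ K, connectedComponentIn K z = connectedComponentIn K x ∨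
      connectedComponentIn K z = connectedComponentIn K y

/-- A domain `U ⊆ ℂ*` is doubly connected if its complement in the Riemann sphere has
exactly two connected components. -/
def DoublyConnected (U : Set ℂ) : Prop :=
  HasExactlyTwoComponents (((fun z : ℂ => (z : OnePoint ℂ)) '' U)ᶜ)

/-- A transcendental entire function. -/
def IsTranscendentalEntire (f : ℂ → ℂ) : Prop :=
  Differentiable ℂ f ∧ ¬ ∃ p : Polynomial ℂ, ∀ z, f z = p.eval z

/-- The Fatou set of an entire function. -/
def FatouSetEntire (f : ℂ → ℂ) : Set ℂ :=
  {z | ∃ U : Set ℂ, IsOpen U ∧ z ∈ U ∧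
    ∀ w ∈ U, ∀ ε : ℝ, 0 < ε → ∃ δ : ℝ, 0 < δ ∧ ∀ w' ∈ U,
      chordalDist w w' < δ → ∀ n : ℕ, chordalDist (f^[n] w) (f^[n] w') < ε}

/-- The Julia set of an entire function. -/
def JuliaSetEntire (f : ℂ → ℂ) : Set ℂ := (FatouSetEntire f)ᶜ

/-- `f` has a finite asymptotic value. -/
def HasFiniteAsymptoticValue (f : ℂ → ℂ) : Prop :=
  ∃ (a : ℂ) (γ : ℝ → ℂ), ContinuousOn γ (Set.Ici (0 : ℝ)) ∧
    Tendsto (fun t => ‖γ t‖) atTop atTop ∧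
    Tendsto (fun t => f (γ t)) atTop (nhds a)

/-! ### A Landau-type estimate -/

/-- A nonvanishing holomorphic function on a disc has a holomorphic logarithm with prescribed
value at the centre. -/
theorem exists_holomorphic_log {p : ℂ → ℂ} {c : ℂ} {r : ℝ} (hr : 0 < r)
    (hp : DifferentiableOn ℂ p (Metric.ball c r)) (h0 : ∀ z ∈ Metric.ball c r, p z ≠ 0)
    {a : ℂ} (ha : Complex.exp a = p c) :
    ∃ F : ℂ → ℂ, DifferentiableOn ℂ F (Metric.ball c r) ∧ F c = a ∧
      ∀ z ∈ Metric.ball c r, Complex.exp (F z) = p z := by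
  have hd : DifferentiableOn ℂ (fun z => deriv p z / p z) (Metric.ball c r) :=
    (hp.deriv Metric.isOpen_ball).div hp h0
  obtain ⟨F, hFc, hF⟩ := hd.isExactOn_ball.with_val_at c a
  refine ⟨F, fun z hz => (hF z hz).differentiableAt.differentiableWithinAt, hFc, ?_⟩
  have key : ∀ z ∈ Metric.ball c r, HasDerivAt (fun z => p z * Complex.exp (-F z)) 0 z := by
    intro z hz
    have h1 : HasDerivAt p (deriv p z) z :=
      (hp.differentiableAt (Metric.isOpen_ball.mem_nhds hz)).hasDerivAt
    have h2 := h1.mul (hF z hz).neg.cexp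
    refine h2.congr_deriv ?_
    have := h0 z hz
    have h3 : p z * (deriv p z / p z) = deriv p z := by field_simp
    simp only [Pi.neg_apply]
    linear_combination (-Complex.exp (-F z)) * h3
  intro z hz
  have hconst := (convex_ball c r).is_const_of_fderivWithin_eq_zero (𝕜 := ℂ)
    (f := fun z => p z * Complex.exp (-F z))
    (fun z hz => (key z hz).differentiableAt.differentiableWithinAt)
    (fun z hz => by
      rw [fderivWithin_of_isOpen Metric.isOpen_ball hz]
      have := (key z hz).hasFDerivAt.fderiv
      rw [this]; ext; simp) hz (Metric.mem_ball_self hr)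
  simp only [hFc, Complex.exp_neg, ha] at hconst
  rw [mul_inv_cancel₀ (h0 c (Metric.mem_ball_self hr))] at hconst
  field_simp at hconst
  exact hconst.symm

/-- A quantitative open mapping statement: if `|L'|` at most doubles in a disc of radius `t`,
then the image of the disc contains a disc of radius proportional to `t |L'(z)|`. -/
theorem ball_subset_image_of_norm_deriv_le {L : ℂ → ℂ} {c : ℂ} {t : ℝ} (ht : 0 < t)
    (hL : DifferentiableOn ℂ L (Metric.ball c t)) (h0 : deriv L c ≠ 0)
    (hb : ∀ z ∈ Metric.ball c t, ‖deriv L z‖ ≤ 2 * ‖deriv L c‖) :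
    Metric.ball (L c) (t * ‖deriv L c‖ / 24) ⊆ L '' Metric.ball c t := by
  set A := ‖deriv L c‖ with hA
  have hApos : 0 < A := norm_pos_iff.2 h0
  have hsub : Metric.closedBall c (t / 6) ⊆ Metric.ball c t :=
    Metric.closedBall_subset_ball (by linarith)
  have hderiv : ∀ z ∈ Metric.closedBall c (t / 6), ‖deriv L z - deriv L c‖ ≤ A / 2 := by
    intro z hz
    have h1 := Complex.dist_le_div_mul_dist_of_mapsTo_ball (f := deriv L) (c := c) (R₁ := t)
      (R₂ := 3 * A) (hL.deriv Metric.isOpen_ball) (fun w hw => by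
        rw [Metric.mem_closedBall, dist_eq_norm]
        calc ‖deriv L w - deriv L c‖ ≤ ‖deriv L w‖ + ‖deriv L c‖ := norm_sub_le _ _
          _ ≤ 3 * A := by linarith [hb w hw]) (hsub hz)
    rw [dist_eq_norm] at h1
    refine h1.trans ?_
    rw [Metric.mem_closedBall] at hz
    calc 3 * A / t * dist z c ≤ 3 * A / t * (t / 6) := by gcongr
      _ = A / 2 := by field_simp; norm_num
  have hlow : ∀ z ∈ Metric.sphere c (t / 6), t * A / 12 ≤ ‖L z - L c‖ := by
    intro z hz
    have hz' := Metric.sphere_subset_closedBall hz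
    have hmv := (convex_closedBall c (t / 6)).norm_image_sub_le_of_norm_hasDerivWithin_le
      (f := fun w => L w - deriv L c * w) (f' := fun w => deriv L w - deriv L c) (C := A / 2)
      (fun w hw => (((hL.differentiableAt
        (Metric.isOpen_ball.mem_nhds (hsub hw))).hasDerivAt.sub
          (by simpa using (hasDerivAt_id w).const_mul (deriv L c))).hasDerivWithinAt)) hderiv
      (Metric.mem_closedBall_self (by positivity)) hz'
    have hzc : ‖z - c‖ = t / 6 := by rwa [mem_sphere_iff_norm] at hz
    have h2 : ‖deriv L c * (z - c)‖ = A * (t / 6) := by rw [norm_mul, hzc]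
    have h3 : deriv L c * (z - c) = (L z - L c)
        - ((L z - deriv L c * z) - (L c - deriv L c * c)) := by ring
    have h4 : ‖deriv L c * (z - c)‖ ≤ ‖L z - L c‖
        + ‖(L z - deriv L c * z) - (L c - deriv L c * c)‖ := by
      rw [h3]; exact norm_sub_le _ _
    rw [h2] at h4
    rw [hzc] at hmv
    linarith
  have hD : DiffContOnCl ℂ L (Metric.ball c (t / 6)) :=
    DifferentiableOn.diffContOnCl (by
      rw [closure_ball c (by positivity)]; exact hL.mono hsub)
  have hfreq : ∃ᶠ z in 𝓝 c, L z ≠ L c := by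
    intro hev
    have hev' : L =ᶠ[𝓝 c] fun _ => L c := by
      filter_upwards [hev] with z hz
      simpa using hz
    exact h0 (by rw [hev'.deriv_eq]; simp)
  have := hD.ball_subset_image_closedBall (by positivity) hlow hfreq
  rw [show t * A / 12 / 2 = t * A / 24 by ring] at this
  exact this.trans (image_mono hsub)

/-- A weak form of Bloch's theorem: a holomorphic function on a disc of radius `r` whose image
contains no disc of radius `4` has derivative `O(1/r)` at the centre. -/
theorem norm_deriv_le_of_omits {L : ℂ → ℂ} {c : ℂ} {r : ℝ} (hr : 0 < r)
    (hL : DifferentiableOn ℂ L (Metric.ball c r))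
    (hom : ∀ a : ℂ, ∃ b ∈ Metric.ball a 4, ∀ z ∈ Metric.ball c r, L z ≠ b) :
    r * ‖deriv L c‖ ≤ 384 := by
  by_cases h0 : deriv L c = 0
  · simp [h0]
  have hApos : 0 < ‖deriv L c‖ := norm_pos_iff.2 h0
  have hsub : Metric.closedBall c (r / 2) ⊆ Metric.ball c r :=
    Metric.closedBall_subset_ball (by linarith)
  have hdc : ContinuousOn (deriv L) (Metric.closedBall c (r / 2)) :=
    (hL.deriv Metric.isOpen_ball).continuousOn.mono hsub
  obtain ⟨z₁, hz₁, hmax⟩ := (isCompact_closedBall c (r / 2)).exists_isMaxOn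
    (Metric.nonempty_closedBall.2 (by positivity))
    (f := fun z => (r / 2 - dist z c) * ‖deriv L z‖)
    (((continuous_const.sub (continuous_id.dist continuous_const)).continuousOn).mul hdc.norm)
  have hcen := hmax (Metric.mem_closedBall_self (x := c) (ε := r / 2) (by positivity))
  simp only [dist_self, sub_zero, mem_ofPred_eq] at hcen
  have hpos : 0 < (r / 2 - dist z₁ c) * ‖deriv L z₁‖ := lt_of_lt_of_le (by positivity) hcen
  have hd1 : 0 ≤ r / 2 - dist z₁ c := by rw [Metric.mem_closedBall] at hz₁; linarith
  have hd2 : 0 < r / 2 - dist z₁ c := by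
    rcases hd1.eq_or_lt with h | h
    · rw [← h] at hpos; simp at hpos
    · exact h
  have hz1 : deriv L z₁ ≠ 0 := by
    intro h; rw [h] at hpos; simp at hpos
  set t := (r / 2 - dist z₁ c) / 2 with ht
  have htpos : 0 < t := by positivity
  have hsub1 : Metric.ball z₁ t ⊆ Metric.closedBall c (r / 2) := by
    intro w hw
    rw [Metric.mem_ball] at hw
    rw [Metric.mem_closedBall]
    have := dist_triangle w z₁ c
    linarith
  have hb : ∀ z ∈ Metric.ball z₁ t, ‖deriv L z‖ ≤ 2 * ‖deriv L z₁‖ := by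
    intro z hz
    have h1 := hmax (hsub1 hz)
    simp only [mem_ofPred_eq] at h1
    rw [Metric.mem_ball] at hz
    have h2 : t ≤ r / 2 - dist z c := by
      have := dist_triangle z z₁ c
      linarith
    have h3 : t * ‖deriv L z‖ ≤ 2 * t * ‖deriv L z₁‖ := by
      calc t * ‖deriv L z‖ ≤ (r / 2 - dist z c) * ‖deriv L z‖ := by gcongr
        _ ≤ _ := h1
        _ = _ := by rw [ht]; ring
    have h4 : t * ‖deriv L z‖ ≤ t * (2 * ‖deriv L z₁‖) := by linarith
    exact le_of_mul_le_mul_left h4 htpos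
  have himg := ball_subset_image_of_norm_deriv_le htpos (hL.mono (hsub1.trans hsub)) hz1 hb
  by_contra hcon
  push Not at hcon
  have h4 : 4 ≤ t * ‖deriv L z₁‖ / 24 := by
    have : t * ‖deriv L z₁‖ = (r / 2 - dist z₁ c) * ‖deriv L z₁‖ / 2 := by rw [ht]; ring
    rw [this]; linarith
  obtain ⟨b, hb1, hb2⟩ := hom (L z₁)
  obtain ⟨z, hz, hzb⟩ := himg (Metric.ball_subset_ball h4 hb1)
  exact hb2 z (hsub (hsub1 hz)) hzb

/-- Every disc of radius `4` contains a point where `cosh` takes an integer value. -/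
theorem exists_cosh_eq_int (a : ℂ) : ∃ b ∈ Metric.ball a 4, ∃ n : ℤ, Complex.cosh b = n := by
  have hreal : ∀ x : ℝ, 0 ≤ x → ∃ y ∈ Icc x (x + 2), ∃ n : ℤ, Real.cosh y = n := by
    intro x hx
    have h2 : Real.cosh x + 1 ≤ Real.cosh (x + 2) := by
      rw [Real.cosh_add]
      have h1 := Real.one_le_cosh x
      have h3 : 0 ≤ Real.sinh x * Real.sinh 2 :=
        mul_nonneg (Real.sinh_nonneg_iff.2 hx) (Real.sinh_nonneg_iff.2 (by norm_num))
      have h4 : 2 ≤ Real.cosh 2 := by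
        have h5 := Real.cosh_sq 1
        have h6 : Real.cosh 2 = Real.cosh 1 ^ 2 + Real.sinh 1 ^ 2 := by
          rw [← Real.cosh_two_mul]; norm_num
        have h7 : 1 ≤ Real.sinh 1 := Real.self_le_sinh_iff.2 zero_le_one
        nlinarith
      nlinarith
    have hmem : ((⌈Real.cosh x⌉ : ℤ) : ℝ) ∈ Icc (Real.cosh x) (Real.cosh (x + 2)) :=
      ⟨Int.le_ceil _, ((Int.ceil_lt_add_one _).le).trans h2⟩
    obtain ⟨y, hy, hy'⟩ := intermediate_value_Icc (by linarith : x ≤ x + 2)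
      Real.continuous_cosh.continuousOn hmem
    exact ⟨y, hy, _, hy'⟩
  obtain ⟨y, hy, n, hn⟩ : ∃ y : ℝ, |y - a.re| ≤ 2 ∧ ∃ n : ℤ, Real.cosh y = n := by
    rcases le_total 0 a.re with h | h
    · obtain ⟨y, hy, n, hn⟩ := hreal _ h
      exact ⟨y, by rw [abs_le]; constructor <;> linarith [hy.1, hy.2], n, hn⟩
    · obtain ⟨y, hy, n, hn⟩ := hreal (-a.re) (by linarith)
      exact ⟨-y, by rw [abs_le]; constructor <;> linarith [hy.1, hy.2], n, by simpa using hn⟩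
  set k : ℤ := round (a.im / Real.pi) with hk
  have hkb : |k * Real.pi - a.im| ≤ 2 := by
    have h1 := abs_sub_round (a.im / Real.pi)
    have h2 : k * Real.pi - a.im = -(a.im / Real.pi - k) * Real.pi := by
      field_simp; ring
    rw [h2, abs_mul, abs_neg, abs_of_pos Real.pi_pos]
    have := Real.pi_lt_four
    nlinarith [abs_nonneg (a.im / Real.pi - k), Real.pi_pos]
  refine ⟨y + (k * Real.pi : ℝ) * Complex.I, ?_, k.negOnePow * n, ?_⟩
  · rw [Metric.mem_ball, dist_eq_norm]
    have hre : ((y + (k * Real.pi : ℝ) * Complex.I : ℂ) - a).re = y - a.re := by simp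
    have him : ((y + (k * Real.pi : ℝ) * Complex.I : ℂ) - a).im = k * Real.pi - a.im := by simp
    have h1 : ‖(y + (k * Real.pi : ℝ) * Complex.I : ℂ) - a‖ ^ 2 ≤ 8 := by
      rw [Complex.sq_norm, Complex.normSq_apply, hre, him]
      nlinarith [abs_le.1 hy, abs_le.1 hkb, sq_abs (y - a.re), sq_abs (k * Real.pi - a.im),
        abs_nonneg (y - a.re), abs_nonneg (k * Real.pi - a.im)]
    nlinarith [norm_nonneg ((y + (k * Real.pi : ℝ) * Complex.I : ℂ) - a)]
  · rw [Complex.cosh_add, Complex.cosh_mul_I, Complex.sinh_mul_I, ← Complex.ofReal_cosh, ← Complex.ofReal_cos,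
      ← Complex.ofReal_sin, hn]
    have h1 : Real.sin (k * Real.pi) = 0 := Real.sin_int_mul_pi k
    have h2 : Real.cos (k * Real.pi) = ((k.negOnePow : ℤ) : ℝ) := by
      have := Real.cos_int_mul_pi k
      rw [this]
      rcases Int.even_or_odd k with h | h
      · rw [Int.negOnePow_even _ h, h.neg_one_zpow]; simp
      · rw [Int.negOnePow_odd _ h, h.neg_one_zpow]; simp
    rw [h1, h2]
    push_cast
    ring

/-- The derivative of a holomorphic function on a disc omitting `2πiℤ` is controlled by the
value at the centre. -/
theorem norm_deriv_le_of_ne_two_pi_int {F : ℂ → ℂ} {c : ℂ} {r : ℝ} (hr : 0 < r)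
    (hF : DifferentiableOn ℂ F (Metric.ball c r))
    (hom : ∀ z ∈ Metric.ball c r, Complex.exp (F z) ≠ 1) :
    r * ‖deriv F c‖ ≤ 384 * (‖F c‖ + 2 * Real.pi) := by
  have hpi : (2 * Real.pi * Complex.I : ℂ) ≠ 0 := Complex.two_pi_I_ne_zero
  have hmemc := Metric.mem_ball_self (x := c) hr
  set H : ℂ → ℂ := fun z => F z / (2 * Real.pi * Complex.I) with hH
  have hHd : DifferentiableOn ℂ H (Metric.ball c r) := hF.div_const _
  have hHint : ∀ z ∈ Metric.ball c r, ∀ n : ℤ, H z ≠ n := by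
    intro z hz n h
    apply hom z hz
    rw [Complex.exp_eq_one_iff]
    exact ⟨n, by rw [← h, hH]; field_simp⟩
  have hsq : ∀ z ∈ Metric.ball c r, H z ^ 2 - 1 ≠ 0 := by
    intro z hz h
    have : (H z - 1) * (H z + 1) = 0 := by linear_combination h
    rcases mul_eq_zero.1 this with h | h
    · exact hHint z hz 1 (by push_cast; linear_combination h)
    · exact hHint z hz (-1) (by push_cast; linear_combination h)
  obtain ⟨l, hl, -, hle⟩ := exists_holomorphic_log hr ((hHd.pow 2).sub_const 1) hsq
    (Complex.exp_log (hsq c hmemc))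
  set s : ℂ → ℂ := fun z => Complex.exp (l z / 2) with hs
  have hsd : DifferentiableOn ℂ s (Metric.ball c r) := (hl.div_const 2).cexp
  have hss : ∀ z ∈ Metric.ball c r, s z ^ 2 = H z ^ 2 - 1 := by
    intro z hz
    rw [hs, ← Complex.exp_nat_mul]
    simp only [Pi.pow_apply] at hle
    rw [← hle z hz]
    congr 1; push_cast; ring
  have hprod : ∀ z ∈ Metric.ball c r, (H z + s z) * (H z - s z) = 1 := by
    intro z hz
    linear_combination -hss z hz
  have hne : ∀ z ∈ Metric.ball c r, H z + s z ≠ 0 := fun z hz h => by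
    have := hprod z hz; rw [h] at this; simp at this
  obtain ⟨L, hL, -, hLe⟩ := exists_holomorphic_log hr (hHd.add hsd) hne
    (Complex.exp_log (hne c hmemc))
  have hLe' : ∀ z ∈ Metric.ball c r, Complex.exp (-L z) = H z - s z := by
    intro z hz
    rw [Complex.exp_neg, hLe z hz]
    exact inv_eq_of_mul_eq_one_right (hprod z hz)
  have hcosh : ∀ z ∈ Metric.ball c r, Complex.cosh (L z) = H z := by
    intro z hz
    rw [Complex.cosh, hLe z hz, hLe' z hz]
    simp only [Pi.add_apply]
    ring
  have hbloch := norm_deriv_le_of_omits hr hL (fun a => by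
    obtain ⟨b, hb, n, hn⟩ := exists_cosh_eq_int a
    refine ⟨b, hb, fun z hz h => hHint z hz n ?_⟩
    rw [← hcosh z hz, h, hn])
  have hderiv : deriv F c = 2 * Real.pi * Complex.I * (Complex.sinh (L c) * deriv L c) := by
    have h1 : HasDerivAt (fun z => 2 * Real.pi * Complex.I * Complex.cosh (L z))
        (2 * Real.pi * Complex.I * (Complex.sinh (L c) * deriv L c)) c :=
      ((hL.differentiableAt (Metric.isOpen_ball.mem_nhds hmemc)).hasDerivAt.ccosh).const_mul _
    have h2 : F =ᶠ[𝓝 c] fun z => 2 * Real.pi * Complex.I * Complex.cosh (L z) := by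
      filter_upwards [Metric.isOpen_ball.mem_nhds hmemc] with z hz
      rw [hcosh z hz, hH]; field_simp
    rw [h2.deriv_eq, h1.deriv]
  have hsinh : ‖Complex.sinh (L c)‖ ≤ ‖H c‖ + 1 := by
    have h1 : ‖Complex.sinh (L c)‖ ^ 2 ≤ ‖H c‖ ^ 2 + 1 := by
      rw [← norm_pow, Complex.sinh_sq, hcosh c hmemc]
      refine (norm_sub_le _ _).trans ?_
      simp
    nlinarith [norm_nonneg (H c), norm_nonneg (Complex.sinh (L c))]
  have hHn : ‖H c‖ = ‖F c‖ / (2 * Real.pi) := by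
    simp [hH, abs_of_pos Real.pi_pos]
  have hn : ‖deriv F c‖ = 2 * Real.pi * (‖Complex.sinh (L c)‖ * ‖deriv L c‖) := by
    rw [hderiv]; simp [abs_of_pos Real.pi_pos]
  have hpp := Real.pi_pos
  calc r * ‖deriv F c‖ = 2 * Real.pi * ‖Complex.sinh (L c)‖ * (r * ‖deriv L c‖) := by
        rw [hn]; ring
    _ ≤ 2 * Real.pi * (‖H c‖ + 1) * 384 := by gcongr
    _ = 384 * (‖F c‖ + 2 * Real.pi) := by rw [hHn]; field_simp

/-- **Landau-type estimate**: the logarithmic derivative of a nonvanishing holomorphic function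
omitting a further value `w`. -/
theorem norm_deriv_le_of_omits_value {p : ℂ → ℂ} {c w : ℂ} {r : ℝ} (hr : 0 < r)
    (hp : DifferentiableOn ℂ p (Metric.ball c r)) (h0 : ∀ z ∈ Metric.ball c r, p z ≠ 0)
    (hw : w ≠ 0) (hom : ∀ z ∈ Metric.ball c r, p z ≠ w) :
    r * ‖deriv p c‖ ≤ ‖p c‖ * (384 * (|Real.log ‖p c‖ - Real.log ‖w‖| + 3 * Real.pi)) := by
  have hmemc := Metric.mem_ball_self (x := c) hr
  have hq0 : ∀ z ∈ Metric.ball c r, p z / w ≠ 0 := fun z hz => div_ne_zero (h0 z hz) hw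
  obtain ⟨F, hF, hFc, hFe⟩ := exists_holomorphic_log hr (hp.div_const w) hq0
    (Complex.exp_log (hq0 c hmemc))
  have h1 := norm_deriv_le_of_ne_two_pi_int hr hF (fun z hz h => by
    rw [hFe z hz, div_eq_one_iff_eq hw] at h
    exact hom z hz h)
  have h2 : deriv p c = p c * deriv F c := by
    have hev : p =ᶠ[𝓝 c] fun z => w * Complex.exp (F z) := by
      filter_upwards [Metric.isOpen_ball.mem_nhds hmemc] with z hz
      rw [hFe z hz]; field_simp
    have hd : HasDerivAt (fun z => w * Complex.exp (F z))
        (w * (Complex.exp (F c) * deriv F c)) c :=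
      ((hF.differentiableAt (Metric.isOpen_ball.mem_nhds hmemc)).hasDerivAt.cexp).const_mul _
    rw [hev.deriv_eq, hd.deriv, hFe c hmemc]
    field_simp
  have h3 : ‖F c‖ ≤ |Real.log ‖p c‖ - Real.log ‖w‖| + Real.pi := by
    rw [hFc]
    refine (Complex.norm_le_abs_re_add_abs_im _).trans ?_
    rw [Complex.log_re, Complex.log_im, norm_div, Real.log_div
      (norm_ne_zero_iff.2 (h0 c hmemc)) (norm_ne_zero_iff.2 hw)]
    gcongr
    exact Complex.abs_arg_le_pi _
  calc r * ‖deriv p c‖ = ‖p c‖ * (r * ‖deriv F c‖) := by rw [h2, norm_mul]; ring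
    _ ≤ ‖p c‖ * (384 * (‖F c‖ + 2 * Real.pi)) := by gcongr
    _ ≤ _ := by
      refine mul_le_mul_of_nonneg_left ?_ (norm_nonneg _)
      linarith

/-! ### Growth and covering properties of transcendental self-maps of the punctured plane -/

/-- The real part of a nonconstant entire function exceeds every multiple of `log ρ` somewhere on
all large circles. -/
theorem eventually_exists_lt_re_of_entire {g : ℂ → ℂ} (hg : Differentiable ℂ g)
    (hnc : ¬ ∃ c : ℂ, ∀ z, g z = c) (A B : ℝ) :
    ∀ᶠ ρ : ℝ in atTop, ∃ z : ℂ, ‖z‖ = ρ ∧ A * Real.log ρ + B < (g z).re := by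
  by_contra hcon
  rw [not_eventually] at hcon
  apply hnc
  refine ⟨g 0, fun z => is_const_of_deriv_eq_zero hg (fun c => ?_) z 0⟩
  by_contra hc
  have hlim : Tendsto (fun ρ : ℝ => 8 * |A| * (Real.log ρ / ρ)
      + (8 * (|B| + 1) + 12 * ‖g 0‖) * ρ⁻¹) atTop (𝓝 0) := by
    have h1 : Tendsto (fun ρ : ℝ => Real.log ρ / ρ) atTop (𝓝 0) :=
      Real.isLittleO_log_id_atTop.tendsto_div_nhds_zero
    simpa using (h1.const_mul (8 * |A|)).add
      (tendsto_inv_atTop_zero.const_mul (8 * (|B| + 1) + 12 * ‖g 0‖))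
  obtain ⟨ρ, hρ, hlt, hρ1, hρc⟩ := (hcon.and_eventually ((hlim.eventually_lt_const
    (norm_pos_iff.2 hc)).and ((eventually_ge_atTop 1).and
      (eventually_gt_atTop (4 * ‖c‖))))).exists
  push Not at hρ
  have hρ0 : 0 < ρ := by linarith
  have hlog := Real.log_nonneg hρ1
  set M := |A| * Real.log ρ + |B| + 1 with hM
  have hMpos : 0 < M := by positivity
  have hsph : ∀ z ∈ frontier (Metric.ball (0 : ℂ) ρ), ‖Complex.exp (g z)‖ ≤ Real.exp M := by
    intro z hz
    rw [frontier_ball _ hρ0.ne', mem_sphere_zero_iff_norm] at hz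
    rw [Complex.norm_exp, Real.exp_le_exp]
    refine (hρ z hz).trans ?_
    have h1 : A * Real.log ρ ≤ |A| * Real.log ρ := by gcongr; exact le_abs_self A
    linarith [le_abs_self B]
  have hball : MapsTo g (Metric.ball 0 ρ) {z | z.re ≤ M} := by
    intro z hz
    have := Complex.norm_le_of_forall_mem_frontier_norm_le Metric.isBounded_ball
      (hg.cexp.diffContOnCl) hsph (subset_closure hz)
    rw [Complex.norm_exp, Real.exp_le_exp] at this
    exact this
  have hbc : ∀ z ∈ Metric.sphere c (ρ / 4), ‖g z‖ ≤ 2 * M + 3 * ‖g 0‖ := by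
    intro z hz
    rw [mem_sphere_iff_norm] at hz
    have hz2 : ‖z‖ ≤ ρ / 2 := by
      have := norm_le_norm_sub_add z c
      linarith
    have h1 := Complex.borelCaratheodory hMpos hg.differentiableOn hball hρ0
      (z := z) (by rw [mem_ball_zero_iff]; linarith)
    have hd : 0 < ρ - ‖z‖ := by linarith
    refine h1.trans (add_le_add ?_ ?_)
    · rw [div_le_iff₀ hd]
      gcongr
      linarith
    · rw [div_le_iff₀ hd]
      nlinarith [norm_nonneg (g 0)]
  have hcauchy := Complex.norm_deriv_le_of_forall_mem_sphere_norm_le (by positivity)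
    hg.diffContOnCl hbc
  have heq : (2 * M + 3 * ‖g 0‖) / (ρ / 4) = 8 * |A| * (Real.log ρ / ρ)
      + (8 * (|B| + 1) + 12 * ‖g 0‖) * ρ⁻¹ := by
    rw [hM]; field_simp; ring
  rw [heq] at hcauchy
  exact absurd hlt (not_lt.2 hcauchy)

namespace IsTranscendentalSelfMapCStar

variable {f : ℂ → ℂ}

theorem inv_apply (hf : IsTranscendentalSelfMapCStar f) :
    IsTranscendentalSelfMapCStar (fun z => (f z)⁻¹) := by
  obtain ⟨m, g, h, hg, hh, hgc, hhc, hfe⟩ := hf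
  refine ⟨-m, fun z => -g z, fun z => -h z, hg.neg, hh.neg, ?_, ?_, ?_⟩
  · rintro ⟨c, hc⟩
    exact hgc ⟨-c, fun z => by rw [← hc z, neg_neg]⟩
  · rintro ⟨c, hc⟩
    exact hhc ⟨-c, fun z => by rw [← hc z, neg_neg]⟩
  · intro z hz
    simp only [hfe z hz, mul_inv, zpow_neg, ← Complex.exp_neg, neg_add]

theorem comp_inv (hf : IsTranscendentalSelfMapCStar f) :
    IsTranscendentalSelfMapCStar (fun z => f z⁻¹) := by
  obtain ⟨m, g, h, hg, hh, hgc, hhc, hfe⟩ := hf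
  refine ⟨-m, h, g, hh, hg, hhc, hgc, ?_⟩
  intro z hz
  simp only [hfe z⁻¹ (inv_ne_zero hz), inv_zpow, zpow_neg, inv_inv, add_comm]

theorem ne_zero (hf : IsTranscendentalSelfMapCStar f) {z : ℂ} (hz : z ≠ 0) : f z ≠ 0 := by
  obtain ⟨m, g, h, hg, hh, hgc, hhc, hfe⟩ := hf
  rw [hfe z hz]
  exact mul_ne_zero (zpow_ne_zero _ hz) (Complex.exp_ne_zero _)

theorem differentiableOn (hf : IsTranscendentalSelfMapCStar f) :
    DifferentiableOn ℂ f {0}ᶜ := by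
  obtain ⟨m, g, h, hg, hh, hgc, hhc, hfe⟩ := hf
  refine DifferentiableOn.congr (f := fun z => z ^ m * Complex.exp (g z + h z⁻¹)) ?_
    (fun z hz => hfe z hz)
  intro z hz
  have h1 : DifferentiableAt ℂ (fun z : ℂ => z ^ m) z := differentiableAt_zpow.2 (Or.inl hz)
  have h2 : DifferentiableAt ℂ (fun z : ℂ => h z⁻¹) z :=
    (hh _).comp z (differentiableAt_inv hz)
  exact (h1.mul ((hg z).add h2).cexp).differentiableWithinAt

theorem differentiableAt (hf : IsTranscendentalSelfMapCStar f) {z : ℂ} (hz : z ≠ 0) :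
    DifferentiableAt ℂ f z :=
  hf.differentiableOn.differentiableAt (isOpen_compl_singleton.mem_nhds hz)

theorem eventually_exists_lt_log (hf : IsTranscendentalSelfMapCStar f) (A : ℝ) :
    ∀ᶠ ρ : ℝ in atTop, ∃ z : ℂ, ‖z‖ = ρ ∧ A * Real.log ρ < Real.log ‖f z‖ := by
  obtain ⟨m, g, h, hg, hh, hgc, hhc, hfe⟩ := hf
  obtain ⟨H, hH⟩ := (isCompact_closedBall (0 : ℂ) 1).exists_bound_of_continuousOn
    hh.continuous.continuousOn
  filter_upwards [eventually_exists_lt_re_of_entire hg hgc (A - m) H, eventually_ge_atTop 1]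
    with ρ hρ hρ1
  obtain ⟨z, hz, hlt⟩ := hρ
  refine ⟨z, hz, ?_⟩
  have hz0 : z ≠ 0 := norm_pos_iff.1 (by linarith)
  have h1 := hH z⁻¹ (by
    rw [mem_closedBall_zero_iff, norm_inv, hz]
    exact inv_le_one_of_one_le₀ hρ1)
  have h2 := (abs_le.1 (Complex.abs_re_le_norm (h z⁻¹))).1
  rw [hfe z hz0, norm_mul, norm_zpow, Complex.norm_exp, hz,
    Real.log_mul (zpow_ne_zero _ (by linarith)) (Real.exp_ne_zero _), Real.log_zpow,
    Real.log_exp, Complex.add_re]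
  linarith

/-- On a large circle there is a point where `|f| = 1`. -/
theorem eventually_exists_norm_eq_one (hf : IsTranscendentalSelfMapCStar f) :
    ∀ᶠ ρ : ℝ in atTop, ∃ t : ℝ, ‖f (circleMap 0 ρ t)‖ = 1 := by
  filter_upwards [hf.eventually_exists_lt_log 0, hf.inv_apply.eventually_exists_lt_log 0,
    eventually_gt_atTop 0] with ρ h1 h2 hρ
  obtain ⟨z₁, hz₁, hl₁⟩ := h1
  obtain ⟨z₂, hz₂, hl₂⟩ := h2
  have hrange : ∀ z : ℂ, ‖z‖ = ρ → ∃ t : ℝ, circleMap 0 ρ t = z := by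
    intro z hz
    have : z ∈ range (circleMap 0 ρ) := by
      rw [range_circleMap, mem_sphere_zero_iff_norm, hz, abs_of_pos hρ]
    exact this
  obtain ⟨t₁, rfl⟩ := hrange z₁ hz₁
  obtain ⟨t₂, rfl⟩ := hrange z₂ hz₂
  have hcont : Continuous fun t => ‖f (circleMap 0 ρ t)‖ := by
    refine Continuous.norm (hf.differentiableOn.continuousOn.comp_continuous
      (continuous_circleMap 0 ρ) (fun t => ?_))
    exact circleMap_ne_center hρ.ne'
  have hp₂ := norm_pos_iff.2 (hf.ne_zero (circleMap_ne_center hρ.ne' : circleMap 0 ρ t₂ ≠ 0))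
  rw [norm_inv, Real.log_inv] at hl₂
  refine mem_range_of_exists_le_of_exists_ge hcont ⟨t₂, ?_⟩ ⟨t₁, ?_⟩
  · exact ((Real.log_neg_iff hp₂).1 (by linarith)).le
  · have hp₁ := norm_pos_iff.2 (hf.ne_zero (circleMap_ne_center hρ.ne' : circleMap 0 ρ t₁ ≠ 0))
    exact ((Real.log_pos_iff hp₁.le).1 (by linarith)).le

end IsTranscendentalSelfMapCStar

/-- The derivative of `log |u|` along a curve `u`. -/
theorem hasDerivAt_log_norm {u : ℝ → ℂ} {u' : ℂ} {t : ℝ} (hu : HasDerivAt u u' t)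
    (h0 : u t ≠ 0) :
    HasDerivAt (fun s => Real.log ‖u s‖) (inner ℝ (u t) u' / ‖u t‖ ^ 2) t := by
  have hn : ‖u t‖ ^ 2 ≠ 0 := pow_ne_zero _ (norm_ne_zero_iff.2 h0)
  have h1 := ((hu.norm_sq).log hn).const_mul (1 / 2 : ℝ)
  refine (h1.congr_deriv (by ring)).congr_of_eventuallyEq ?_
  filter_upwards with s
  rw [Real.log_pow]; push_cast; ring

namespace IsTranscendentalSelfMapCStar

variable {f : ℂ → ℂ}

/-- If `f` omits a value `w` on `1 < |z| < 2ρ` and `|f| = 1` somewhere on `|z| = ρ`, then `log |f|`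
is controlled on `|z| = ρ` by `log |w|`. -/
theorem log_norm_le_of_omits (hf : IsTranscendentalSelfMapCStar f) {ρ : ℝ} (hρ : 2 < ρ) {w : ℂ}
    (hw : w ≠ 0) (hom : ∀ z : ℂ, 1 < ‖z‖ → ‖z‖ < 2 * ρ → f z ≠ w)
    {t₀ : ℝ} (ht₀ : ‖f (circleMap 0 ρ t₀)‖ = 1) {z : ℂ} (hz : ‖z‖ = ρ) :
    Real.log ‖f z‖ ≤
      |Real.log ‖w‖| + (|Real.log ‖w‖| + 3 * Real.pi) * Real.exp (768 * (2 * Real.pi)) := by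
  have hρ0 : 0 < ρ := by linarith
  set φ : ℝ → ℝ := fun t => Real.log ‖f (circleMap 0 ρ t)‖ - Real.log ‖w‖ with hφ
  set φ' : ℝ → ℝ := fun t => inner ℝ (f (circleMap 0 ρ t))
    (deriv f (circleMap 0 ρ t) * (circleMap 0 ρ t * Complex.I)) / ‖f (circleMap 0 ρ t)‖ ^ 2
  have hne : ∀ t, circleMap 0 ρ t ≠ 0 := fun t => circleMap_ne_center hρ0.ne'
  have hder : ∀ t, HasDerivAt φ (φ' t) t := by
    intro t
    have h1 : HasDerivAt (fun t => f (circleMap 0 ρ t))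
        (deriv f (circleMap 0 ρ t) * (circleMap 0 ρ t * Complex.I)) t :=
      (hf.differentiableAt (hne t)).hasDerivAt.comp t (hasDerivAt_circleMap 0 ρ t)
    exact (hasDerivAt_log_norm h1 (hf.ne_zero (hne t))).sub_const _
  have hbound : ∀ t, ‖φ' t‖ ≤ 768 * ‖φ t‖ + 768 * (3 * Real.pi) := by
    intro t
    have hn : ‖circleMap 0 ρ t‖ = ρ := by simp [abs_of_pos hρ0]
    have hball : ∀ z ∈ Metric.ball (circleMap 0 ρ t) (ρ / 2), 1 < ‖z‖ ∧ ‖z‖ < 2 * ρ := by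
      intro z hz
      rw [mem_ball_iff_norm] at hz
      have h1 := norm_le_norm_sub_add z (circleMap 0 ρ t)
      have h2 := norm_sub_norm_le (circleMap 0 ρ t) z
      rw [norm_sub_rev] at h2
      constructor <;> linarith
    have hb0 : ∀ z ∈ Metric.ball (circleMap 0 ρ t) (ρ / 2), z ≠ 0 := by
      intro z hz h
      have := (hball z hz).1
      rw [h, norm_zero] at this
      linarith
    have hL := norm_deriv_le_of_omits_value (p := f) (by positivity : 0 < ρ / 2)
      (hf.differentiableOn.mono hb0) (fun z hz => hf.ne_zero (hb0 z hz)) hw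
      (fun z hz => hom z (hball z hz).1 (hball z hz).2)
    have hfp : 0 < ‖f (circleMap 0 ρ t)‖ := norm_pos_iff.2 (hf.ne_zero (hne t))
    have hin := abs_real_inner_le_norm (f (circleMap 0 ρ t))
      (deriv f (circleMap 0 ρ t) * (circleMap 0 ρ t * Complex.I))
    rw [norm_mul, norm_mul, hn, Complex.norm_I, mul_one] at hin
    simp only [φ', hφ, Real.norm_eq_abs]
    rw [abs_div, abs_of_pos (pow_pos hfp 2), div_le_iff₀ (pow_pos hfp 2)]
    refine hin.trans ?_
    calc ‖f (circleMap 0 ρ t)‖ * (‖deriv f (circleMap 0 ρ t)‖ * ρ)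
        = 2 * ‖f (circleMap 0 ρ t)‖ * (ρ / 2 * ‖deriv f (circleMap 0 ρ t)‖) := by ring
      _ ≤ 2 * ‖f (circleMap 0 ρ t)‖ * (‖f (circleMap 0 ρ t)‖ *
          (384 * (|Real.log ‖f (circleMap 0 ρ t)‖ - Real.log ‖w‖| + 3 * Real.pi))) := by gcongr
      _ = _ := by ring
  obtain ⟨s, hs⟩ : z ∈ range (circleMap 0 ρ) := by
    rw [range_circleMap, mem_sphere_zero_iff_norm, hz, abs_of_pos hρ0]
  obtain ⟨t, ht, hst⟩ := (periodic_circleMap 0 ρ).exists_mem_Ioc Real.two_pi_pos s t₀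
  rw [hst] at hs
  have hφ0 : ‖φ t₀‖ ≤ |Real.log ‖w‖| := by simp [hφ, ht₀]
  have hgr := norm_le_gronwallBound_of_norm_deriv_right_le (f := φ) (f' := φ')
    (a := t₀) (b := t₀ + 2 * Real.pi)
    (fun t _ => (hder t).continuousAt.continuousWithinAt)
    (fun t _ => (hder t).hasDerivWithinAt) hφ0 (fun t _ => hbound t) t (Ioc_subset_Icc_self ht)
  rw [gronwallBound_of_K_ne_0 (by norm_num)] at hgr
  simp only [mul_div_cancel_left₀ (3 * Real.pi) (by norm_num : (768 : ℝ) ≠ 0)] at hgr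
  have hexp : Real.exp (768 * (t - t₀)) ≤ Real.exp (768 * (2 * Real.pi)) := by
    rw [Real.exp_le_exp]; linarith [ht.2]
  have h1 := (abs_le.1 hgr).2
  simp only [hφ, hs] at h1
  have h2 := le_abs_self (Real.log ‖w‖)
  have h3 : (|Real.log ‖w‖| + 3 * Real.pi) * Real.exp (768 * (t - t₀))
      ≤ (|Real.log ‖w‖| + 3 * Real.pi) * Real.exp (768 * (2 * Real.pi)) := by gcongr
  linarith [Real.pi_pos]

/-- A quantitative version of Picard's theorem: for large `R`, the annulus `1 < |z| < R` is mapped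
onto a set containing `1 / (2 * R) ≤ |w| ≤ 2 * R`. -/
theorem eventually_annulus_subset_image (hf : IsTranscendentalSelfMapCStar f) :
    ∀ᶠ R : ℝ in atTop, ∀ w : ℂ, w ≠ 0 → |Real.log ‖w‖| ≤ Real.log (2 * R) →
      ∃ z : ℂ, 1 < ‖z‖ ∧ ‖z‖ < R ∧ f z = w := by
  set E := Real.exp (768 * (2 * Real.pi)) with hE
  have key : ∀ᶠ ρ : ℝ in atTop, ∀ w : ℂ, w ≠ 0 → |Real.log ‖w‖| ≤ Real.log (4 * ρ) →
      ∃ z : ℂ, 1 < ‖z‖ ∧ ‖z‖ < 2 * ρ ∧ f z = w := by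
    filter_upwards [hf.eventually_exists_lt_log (2 + 2 * E), hf.eventually_exists_norm_eq_one,
      eventually_gt_atTop 2, Real.tendsto_log_atTop.eventually_ge_atTop
        (Real.log 4 + 3 * Real.pi)] with ρ h1 h2 h3 h4 w hw hwl
    by_contra hcon
    push Not at hcon
    obtain ⟨z, hz, hlt⟩ := h1
    obtain ⟨t₀, ht₀⟩ := h2
    have h5 := hf.log_norm_le_of_omits h3 hw hcon ht₀ hz
    rw [Real.log_mul (by norm_num) (by linarith)] at hwl
    have hEpos : 0 < E := Real.exp_pos _
    have h6 : |Real.log ‖w‖| + 3 * Real.pi ≤ 2 * Real.log ρ := by linarith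
    have h7 : (|Real.log ‖w‖| + 3 * Real.pi) * E ≤ 2 * Real.log ρ * E := by gcongr
    nlinarith [Real.pi_pos]
  have hdiv : Tendsto (fun R : ℝ => R / 2) atTop atTop :=
    tendsto_id.atTop_div_const (by norm_num)
  filter_upwards [hdiv.eventually key] with R hR w hw hwl
  obtain ⟨z, h1, h2, h3⟩ := hR w hw (by rwa [show 4 * (R / 2) = 2 * R by ring])
  exact ⟨z, h1, by linarith, h3⟩

end IsTranscendentalSelfMapCStar

/-! ### The blow-up property of the Julia set -/

/-- The chordal distance in terms of the coordinates of the stereographic projection. -/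
theorem chordalDist_le_stereographic (z w : ℂ) :
    chordalDist z w ≤ ‖(1 + ‖z‖ ^ 2)⁻¹ • z - (1 + ‖w‖ ^ 2)⁻¹ • w‖
      + ‖(1 + ‖z‖ ^ 2)⁻¹ - (1 + ‖w‖ ^ 2)⁻¹‖ := by
  have ha : 0 < 1 + ‖z‖ ^ 2 := by positivity
  have hb : 0 < 1 + ‖w‖ ^ 2 := by positivity
  have hsq : chordalDist z w ^ 2 = ‖(1 + ‖z‖ ^ 2)⁻¹ • z - (1 + ‖w‖ ^ 2)⁻¹ • w‖ ^ 2
      + ‖(1 + ‖z‖ ^ 2)⁻¹ - (1 + ‖w‖ ^ 2)⁻¹‖ ^ 2 := by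
    rw [chordalDist, div_pow, Real.sq_sqrt (by positivity), Real.norm_eq_abs, sq_abs]
    simp only [Complex.sq_norm, Complex.normSq_apply] at *
    simp only [Complex.sub_re, Complex.sub_im, Complex.real_smul, Complex.mul_re, Complex.mul_im,
      Complex.ofReal_re, Complex.ofReal_im, zero_mul, sub_zero, add_zero]
    field_simp
    ring
  have h1 := norm_nonneg ((1 + ‖z‖ ^ 2)⁻¹ • z - (1 + ‖w‖ ^ 2)⁻¹ • w)
  have h2 := norm_nonneg ((1 + ‖z‖ ^ 2)⁻¹ - (1 + ‖w‖ ^ 2)⁻¹)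
  refine le_of_sq_le_sq ?_ (by positivity)
  rw [hsq]
  nlinarith [mul_nonneg h1 h2]

/-- A bound on the spherical derivative gives a Lipschitz bound for the chordal distance. -/
theorem chordalDist_le_of_norm_deriv_le {p : ℂ → ℂ} {U : Set ℂ} (hU : Convex ℝ U) {K : ℝ}
    (hp : ∀ z ∈ U, DifferentiableAt ℂ p z)
    (hK : ∀ z ∈ U, ‖deriv p z‖ ≤ K * (1 + ‖p z‖ ^ 2)) {z w : ℂ} (hz : z ∈ U) (hw : w ∈ U) :
    chordalDist (p z) (p w) ≤ 4 * K * ‖z - w‖ := by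
  set l : ℝ → ℂ := fun t => w + t * (z - w) with hl
  have hlU : ∀ t ∈ Icc (0 : ℝ) 1, l t ∈ U := by
    intro t ht
    have := hU.add_smul_sub_mem hw hz ht
    simpa [hl] using this
  have hlder : ∀ t, HasDerivAt l (z - w) t := by
    intro t
    have h := ((Complex.ofRealCLM.hasDerivAt (x := t)).mul_const (z - w)).const_add w
    exact h.congr_deriv (by simp)
  set u : ℝ → ℂ := fun t => p (l t) with hu
  set u' : ℝ → ℂ := fun t => deriv p (l t) * (z - w) with hu'
  have hud : ∀ t ∈ Icc (0 : ℝ) 1, HasDerivAt u (u' t) t := fun t ht =>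
    (hp _ (hlU t ht)).hasDerivAt.comp t (hlder t)
  set d : ℝ → ℝ := fun t => 1 + ‖u t‖ ^ 2 with hd
  have hdpos : ∀ t, 0 < d t := fun t => by positivity
  have hu'b : ∀ t ∈ Icc (0 : ℝ) 1, ‖u' t‖ ≤ K * ‖z - w‖ * d t := by
    intro t ht
    rw [hu', norm_mul]
    calc ‖deriv p (l t)‖ * ‖z - w‖ ≤ K * (1 + ‖p (l t)‖ ^ 2) * ‖z - w‖ := by
          gcongr; exact hK _ (hlU t ht)
      _ = _ := by ring
  have hin : ∀ t, |inner ℝ (u t) (u' t)| ≤ ‖u t‖ * ‖u' t‖ := fun t =>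
    abs_real_inner_le_norm _ _
  have hdd : ∀ t ∈ Icc (0 : ℝ) 1, HasDerivAt (fun t => (d t)⁻¹)
      (-(2 * inner ℝ (u t) (u' t)) / d t ^ 2) t := fun t ht =>
    (((hud t ht).norm_sq).const_add 1).inv (hdpos t).ne'
  have hYb : ∀ t ∈ Icc (0 : ℝ) 1, ‖-(2 * inner ℝ (u t) (u' t)) / d t ^ 2‖ ≤ K * ‖z - w‖ := by
    intro t ht
    rw [Real.norm_eq_abs, abs_div, abs_neg, abs_mul, abs_two, abs_of_pos (pow_pos (hdpos t) 2),
      div_le_iff₀ (pow_pos (hdpos t) 2)]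
    have h1 : 2 * ‖u t‖ ≤ d t := by simp only [hd]; nlinarith [sq_nonneg (‖u t‖ - 1)]
    calc 2 * |inner ℝ (u t) (u' t)| ≤ 2 * (‖u t‖ * ‖u' t‖) := by gcongr; exact hin t
      _ = (2 * ‖u t‖) * ‖u' t‖ := by ring
      _ ≤ d t * (K * ‖z - w‖ * d t) :=
          mul_le_mul h1 (hu'b t ht) (norm_nonneg _) (hdpos t).le
      _ = _ := by ring
  have hXd : ∀ t ∈ Icc (0 : ℝ) 1, HasDerivAt (fun t => (d t)⁻¹ • u t)
      ((d t)⁻¹ • u' t + (-(2 * inner ℝ (u t) (u' t)) / d t ^ 2) • u t) t := fun t ht =>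
    (hdd t ht).smul (hud t ht)
  have hXb : ∀ t ∈ Icc (0 : ℝ) 1,
      ‖(d t)⁻¹ • u' t + (-(2 * inner ℝ (u t) (u' t)) / d t ^ 2) • u t‖
        ≤ 3 * (K * ‖z - w‖) := by
    intro t ht
    refine (norm_add_le _ _).trans ?_
    have h1 : ‖(d t)⁻¹ • u' t‖ ≤ K * ‖z - w‖ := by
      rw [norm_smul, norm_inv, Real.norm_of_nonneg (hdpos t).le, inv_mul_le_iff₀ (hdpos t)]
      linarith [hu'b t ht]
    have h2 : ‖(-(2 * inner ℝ (u t) (u' t)) / d t ^ 2) • u t‖ ≤ 2 * (K * ‖z - w‖) := by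
      rw [norm_smul, Real.norm_eq_abs, abs_div, abs_neg, abs_mul, abs_two,
        abs_of_pos (pow_pos (hdpos t) 2), div_mul_eq_mul_div, div_le_iff₀ (pow_pos (hdpos t) 2)]
      have h3 : ‖u t‖ ^ 2 ≤ d t := by simp only [hd]; linarith
      calc 2 * |inner ℝ (u t) (u' t)| * ‖u t‖ ≤ 2 * (‖u t‖ * ‖u' t‖) * ‖u t‖ := by
            gcongr; exact hin t
        _ = 2 * (‖u t‖ ^ 2 * ‖u' t‖) := by ring
        _ ≤ 2 * (d t * (K * ‖z - w‖ * d t)) := by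
            gcongr
            exact hu'b t ht
        _ = _ := by ring
    linarith
  have hX := norm_image_sub_le_of_norm_deriv_le_segment_01'
    (fun t ht => (hXd t ht).hasDerivWithinAt)
    (fun t ht => hXb t (Ico_subset_Icc_self ht))
  have hY := norm_image_sub_le_of_norm_deriv_le_segment_01'
    (fun t ht => (hdd t ht).hasDerivWithinAt)
    (fun t ht => hYb t (Ico_subset_Icc_self ht))
  have h0 : u 0 = p w := by simp [hu, hl]
  have h1 : u 1 = p z := by simp [hu, hl]
  simp only [hd, h0, h1] at hX hY
  refine (chordalDist_le_stereographic _ _).trans ?_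
  linarith

namespace IsTranscendentalSelfMapCStar

variable {f : ℂ → ℂ}

theorem iterate_ne_zero (hf : IsTranscendentalSelfMapCStar f) (n : ℕ) {z : ℂ} (hz : z ≠ 0) :
    f^[n] z ≠ 0 := by
  induction n with
  | zero => exact hz
  | succ n ih => rw [iterate_succ_apply']; exact hf.ne_zero ih

theorem iterate_differentiableOn (hf : IsTranscendentalSelfMapCStar f) (n : ℕ) :
    DifferentiableOn ℂ f^[n] {0}ᶜ :=
  hf.differentiableOn.iterate (fun _ hz => hf.ne_zero hz) n

theorem isOpen_image (hf : IsTranscendentalSelfMapCStar f) {s : Set ℂ} (hs : IsOpen s)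
    (h0 : s ⊆ {0}ᶜ) : IsOpen (f '' s) := by
  have hpre : IsPreconnected ({0}ᶜ : Set ℂ) :=
    (isConnected_compl_singleton_of_one_lt_rank (by simp) 0).isPreconnected
  rcases (hf.differentiableOn.analyticOnNhd isOpen_compl_singleton).is_constant_or_isOpen hpre with
    ⟨w, hw⟩ | h
  · exfalso
    obtain ⟨ρ, ⟨z₁, hz₁, hl₁⟩, ⟨z₂, hz₂, hl₂⟩, hρ⟩ := ((hf.eventually_exists_lt_log 0).and
      ((hf.inv_apply.eventually_exists_lt_log 0).and (eventually_gt_atTop 0))).exists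
    have h1 : z₁ ≠ 0 := norm_pos_iff.1 (by rw [hz₁]; exact hρ)
    have h2 : z₂ ≠ 0 := norm_pos_iff.1 (by rw [hz₂]; exact hρ)
    rw [hw z₁ h1] at hl₁
    rw [norm_inv, Real.log_inv, hw z₂ h2] at hl₂
    linarith
  · exact h s h0 hs

theorem isOpen_iterate_image (hf : IsTranscendentalSelfMapCStar f) (n : ℕ) {s : Set ℂ}
    (hs : IsOpen s) (h0 : s ⊆ {0}ᶜ) : IsOpen (f^[n] '' s) := by
  induction n with
  | zero => simpa using hs
  | succ n ih =>
    rw [iterate_succ', image_comp]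
    refine hf.isOpen_image ih ?_
    rintro _ ⟨z, hz, rfl⟩
    exact hf.iterate_ne_zero n (h0 hz)

/-- If each iterate of `f` omits on a disc some value of a fixed annulus, then the centre of the
disc belongs to the Fatou set. -/
theorem mem_fatouSet_of_omits (hf : IsTranscendentalSelfMapCStar f) {z₀ : ℂ} {r : ℝ} (hr : 0 < r)
    (h0 : Metric.ball z₀ (2 * r) ⊆ {0}ᶜ) {R : ℝ} {w : ℕ → ℂ} (hw : ∀ n, w n ≠ 0)
    (hwR : ∀ n, |Real.log ‖w n‖| ≤ R)
    (hom : ∀ n, ∀ z ∈ Metric.ball z₀ (2 * r), f^[n] z ≠ w n) : z₀ ∈ FatouSet f := by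
  have hR0 : 0 ≤ R := (abs_nonneg _).trans (hwR 0)
  have hsub : Metric.ball z₀ r ⊆ Metric.ball z₀ (2 * r) := Metric.ball_subset_ball (by linarith)
  have hlogb : ∀ t : ℝ, 0 < t → t * |Real.log t| ≤ t ^ 2 + 1 := by
    intro t ht
    rcases abs_cases (Real.log t) with ⟨h, -⟩ | ⟨h, -⟩ <;> rw [h]
    · nlinarith [Real.log_le_sub_one_of_pos ht]
    · have h1 := Real.log_le_sub_one_of_pos (inv_pos.2 ht)
      rw [Real.log_inv] at h1
      have h2 : t * -Real.log t ≤ t * (t⁻¹ - 1) := by gcongr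
      rw [mul_sub, mul_inv_cancel₀ ht.ne'] at h2
      nlinarith
  set K := 384 * (1 + R + 3 * Real.pi) / r with hKdef
  have hKpos : 0 < K := by have := Real.pi_pos; positivity
  have hK : ∀ n, ∀ z ∈ Metric.ball z₀ r, ‖deriv f^[n] z‖ ≤ K * (1 + ‖f^[n] z‖ ^ 2) := by
    intro n z hz
    have hzb : Metric.ball z r ⊆ Metric.ball z₀ (2 * r) := by
      refine Metric.ball_subset_ball' ?_
      rw [Metric.mem_ball] at hz
      linarith
    have h1 := norm_deriv_le_of_omits_value hr
      ((hf.iterate_differentiableOn n).mono (hzb.trans h0))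
      (fun y hy => hf.iterate_ne_zero n (h0 (hzb hy))) (hw n) (fun y hy => hom n y (hzb hy))
    set t := ‖f^[n] z‖ with ht
    have htpos : 0 < t := norm_pos_iff.2 (hf.iterate_ne_zero n (h0 (hsub hz)))
    have h2 : |Real.log t - Real.log ‖w n‖| ≤ |Real.log t| + R :=
      (abs_sub _ _).trans (by linarith [hwR n])
    have h3 : t * (384 * (|Real.log t - Real.log ‖w n‖| + 3 * Real.pi))
        ≤ t * (384 * (|Real.log t| + R + 3 * Real.pi)) := by gcongr
    have h4 : t ≤ 1 + t ^ 2 := by nlinarith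
    have h5 : t * (R + 3 * Real.pi) ≤ (1 + t ^ 2) * (R + 3 * Real.pi) := by
      have := Real.pi_pos; gcongr
    rw [hKdef, div_mul_eq_mul_div, le_div_iff₀ hr]
    nlinarith [hlogb t htpos]
  set M := ‖z₀‖ + r with hM
  have hMb : ∀ z ∈ Metric.ball z₀ r, ‖z‖ ≤ M := by
    intro z hz
    rw [mem_ball_iff_norm] at hz
    have := norm_le_norm_sub_add z z₀
    linarith
  refine ⟨fun h => h0 (Metric.mem_ball_self (by linarith)) h, Metric.ball z₀ r, Metric.isOpen_ball,
    Metric.mem_ball_self hr, fun z hz => h0 (hsub hz), ?_⟩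
  intro z hz ε hε
  refine ⟨ε / (4 * K * (1 + M ^ 2)), by positivity, fun y hy hzy n => ?_⟩
  have h1 := chordalDist_le_of_norm_deriv_le (convex_ball z₀ r)
    (fun x hx => (hf.iterate_differentiableOn n).differentiableAt
      (isOpen_compl_singleton.mem_nhds (h0 (hsub hx)))) (hK n) hz hy
  have h2 : ‖z - y‖ ≤ chordalDist z y * (1 + M ^ 2) := by
    have hs : Real.sqrt ((1 + ‖z‖ ^ 2) * (1 + ‖y‖ ^ 2)) ≤ 1 + M ^ 2 := by
      have hz' := pow_le_pow_left₀ (norm_nonneg z) (hMb z hz) 2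
      have hy' := pow_le_pow_left₀ (norm_nonneg y) (hMb y hy) 2
      rw [Real.sqrt_le_left (by positivity), sq (1 + M ^ 2)]
      exact mul_le_mul (by linarith) (by linarith) (by positivity) (by positivity)
    have hpos : 0 < Real.sqrt ((1 + ‖z‖ ^ 2) * (1 + ‖y‖ ^ 2)) := by positivity
    calc ‖z - y‖ = chordalDist z y * Real.sqrt ((1 + ‖z‖ ^ 2) * (1 + ‖y‖ ^ 2)) := by
          rw [chordalDist, div_mul_cancel₀ _ hpos.ne']
      _ ≤ _ := by
          gcongr
          exact div_nonneg (norm_nonneg _) hpos.le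
  rw [lt_div_iff₀ (by positivity)] at hzy
  calc chordalDist (f^[n] z) (f^[n] y) ≤ 4 * K * ‖z - y‖ := h1
    _ ≤ 4 * K * (chordalDist z y * (1 + M ^ 2)) := by gcongr
    _ < ε := by linarith

/-- **Blow-up property**: some iterate of an open set meeting the Julia set covers a given
compact annulus. -/
theorem exists_annulus_subset_iterate_image (hf : IsTranscendentalSelfMapCStar f) {G : Set ℂ}
    (hG : IsOpen G) (h0 : G ⊆ {0}ᶜ) (hGJ : (G ∩ JuliaSet f).Nonempty) (R : ℝ) :
    ∃ n : ℕ, ∀ w : ℂ, w ≠ 0 → |Real.log ‖w‖| ≤ R → w ∈ f^[n] '' G := by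
  obtain ⟨z₀, hz₀, hz₀J⟩ := hGJ
  obtain ⟨r, hr, hrG⟩ := Metric.isOpen_iff.1 hG z₀ hz₀
  by_contra hcon
  push Not at hcon
  choose w hw hwR hom using hcon
  have hr2 : Metric.ball z₀ (2 * (r / 2)) ⊆ G := by rwa [mul_div_cancel₀ _ (two_ne_zero' ℝ)]
  exact hz₀J.2 (hf.mem_fatouSet_of_omits (half_pos hr) (hr2.trans h0) hw hwR
    (fun n z hz h => hom n ⟨z, hr2 hz, h⟩))

end IsTranscendentalSelfMapCStar

/-! ### Orbits with prescribed itinerary -/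

/-- Filling in the disc `|w| < S` in the image of `V`. -/
theorem frontier_image_union_ball_subset {p : ℂ → ℂ} {Q V : Set ℂ} {S : ℝ} (hQ : IsCompact Q)
    (hp : ContinuousOn p Q) (hVQ : V ⊆ Q) (hV : IsOpen (p '' V))
    (hS : Metric.sphere 0 S ⊆ p '' V) :
    frontier (p '' V ∪ Metric.ball 0 S) ⊆ p '' (Q \ V) \ Metric.closedBall 0 S := by
  intro x hx
  rw [(hV.union Metric.isOpen_ball).frontier_eq] at hx
  obtain ⟨hxc, hxn⟩ := hx
  rw [mem_union, not_or] at hxn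
  have hxS : S < ‖x‖ := by
    have h1 : S ≤ ‖x‖ := by simpa using hxn.2
    refine lt_of_le_of_ne h1 fun h => hxn.1 (hS ?_)
    rw [mem_sphere_zero_iff_norm, h]
  have hcl : closure (p '' V ∪ Metric.ball 0 S) ⊆ p '' Q ∪ Metric.closedBall 0 S :=
    closure_minimal (union_subset_union (image_mono hVQ) Metric.ball_subset_closedBall)
      ((hQ.image_of_continuousOn hp).isClosed.union Metric.isClosed_closedBall)
  have hxS' : x ∉ Metric.closedBall 0 S := by simpa using hxS
  refine ⟨?_, hxS'⟩
  obtain ⟨q, hq, rfl⟩ := (hcl hxc).resolve_right hxS'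
  exact ⟨q, ⟨hq, fun hqV => hxn.1 ⟨q, hqV, rfl⟩⟩, rfl⟩

/-- A bounded open neighbourhood of the closed disc of radius `R` about `0`. -/
def IsBoundedOpenNhd (R : ℝ) (U : Set ℂ) : Prop :=
  IsOpen U ∧ Bornology.IsBounded U ∧ Metric.closedBall 0 R ⊆ U

theorem isBoundedOpenNhd_image_union_ball {p : ℂ → ℂ} {Q V : Set ℂ} {S : ℝ} (hQ : IsCompact Q)
    (hp : ContinuousOn p Q) (hVQ : V ⊆ Q) (hV : IsOpen (p '' V))
    (hS : Metric.sphere 0 S ⊆ p '' V) : IsBoundedOpenNhd S (p '' V ∪ Metric.ball 0 S) := by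
  refine ⟨hV.union Metric.isOpen_ball,
    ((hQ.image_of_continuousOn hp).isBounded.subset (image_mono hVQ)).union
      Metric.isBounded_ball, ?_⟩
  rw [← Metric.sphere_union_ball]
  exact union_subset_union_left _ hS

namespace IsBoundedOpenNhd

variable {R : ℝ} {U : Set ℂ}

theorem isCompact_frontier (hU : IsBoundedOpenNhd R U) : IsCompact (frontier U) :=
  hU.2.1.isCompact_closure.of_isClosed_subset isClosed_frontier frontier_subset_closure

theorem lt_norm_of_mem_frontier (hU : IsBoundedOpenNhd R U) {z : ℂ} (hz : z ∈ frontier U) :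
    R < ‖z‖ := by
  by_contra h
  rw [hU.1.frontier_eq] at hz
  exact hz.2 (hU.2.2 (by simpa using h))

theorem frontier_nonempty (hR : 0 ≤ R) (hU : IsBoundedOpenNhd R U) : (frontier U).Nonempty := by
  rw [nonempty_frontier_iff]
  refine ⟨⟨0, hU.2.2 (by simpa using hR)⟩, fun h => ?_⟩
  exact NormedSpace.unbounded_univ ℝ ℂ (h ▸ hU.2.1)

end IsBoundedOpenNhd

/-- Given compact sets `E k` with `E (k + 1) ⊆ f (E k)`, some orbit passes through all of them. -/
theorem exists_forall_iterate_mem {f : ℂ → ℂ} {E : ℕ → Set ℂ} {Ω : Set ℂ}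
    (hE : ∀ k, IsCompact (E k)) (hne : ∀ k, (E k).Nonempty) (hΩ : E 0 ⊆ Ω)
    (hf : ∀ k, ContinuousOn f^[k] Ω) (hsub : ∀ k, E (k + 1) ⊆ f '' E k) :
    ∃ z ∈ E 0, ∀ k, f^[k] z ∈ E k := by
  have hback : ∀ k, ∀ y ∈ E k, ∃ x ∈ E 0, f^[k] x = y ∧ ∀ j ≤ k, f^[j] x ∈ E j := by
    intro k
    induction k with
    | zero =>
      intro y hy
      exact ⟨y, hy, rfl, fun j hj => by rw [Nat.le_zero.1 hj]; exact hy⟩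
    | succ k ih =>
      intro y hy
      obtain ⟨y', hy', rfl⟩ := hsub k hy
      obtain ⟨x, hx, rfl, hj⟩ := ih y' hy'
      refine ⟨x, hx, iterate_succ_apply' f k x, fun j hjk => ?_⟩
      rcases Nat.le_succ_iff.1 hjk with h | rfl
      · exact hj j h
      · rwa [iterate_succ_apply']
  have hclosed : ∀ j, IsClosed (E 0 ∩ f^[j] ⁻¹' E j) := fun j =>
    ((hf j).mono hΩ).preimage_isClosed_of_isClosed (hE 0).isClosed (hE j).isClosed
  obtain ⟨z, hz⟩ := IsCompact.nonempty_iInter_of_sequence_nonempty_isCompact_isClosed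
    (fun k => ⋂ j ∈ Iic k, (E 0 ∩ f^[j] ⁻¹' E j))
    (fun k => biInter_subset_biInter_left (Iic_subset_Iic.2 (Nat.le_succ k)))
    (fun k => by
      obtain ⟨y, hy⟩ := hne k
      obtain ⟨x, hx, -, hj⟩ := hback k y hy
      exact ⟨x, mem_iInter₂.2 fun j hjk => ⟨hx, hj j hjk⟩⟩)
    (by
      refine (hE 0).of_isClosed_subset (isClosed_biInter fun j _ => hclosed j) ?_
      exact (biInter_subset_of_mem (mem_Iic.2 le_rfl)).trans inter_subset_left)
    (fun k => isClosed_biInter fun j _ => hclosed j)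
  rw [mem_iInter] at hz
  have hz' : ∀ k, z ∈ E 0 ∩ f^[k] ⁻¹' E k := fun k => mem_iInter₂.1 (hz k) k (mem_Iic.2 le_rfl)
  exact ⟨z, (hz' 0).1, fun k => (hz' k).2⟩

/-- The identity or the inversion, according to the end of the punctured plane considered. -/
def endChart : Bool → ℂ → ℂ
  | true => fun z => z
  | false => fun z => z⁻¹

theorem endChart_endChart (b : Bool) (z : ℂ) : endChart b (endChart b z) = z := by
  cases b <;> simp [endChart]

theorem endChart_ne_zero (b : Bool) {z : ℂ} (hz : z ≠ 0) : endChart b z ≠ 0 := by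
  cases b <;> simpa [endChart] using hz

theorem continuousOn_endChart (b : Bool) : ContinuousOn (endChart b) {0}ᶜ := by
  cases b
  · exact continuousOn_inv₀
  · exact continuousOn_id

theorem abs_log_norm_endChart (b : Bool) (z : ℂ) :
    |Real.log ‖endChart b z‖| = |Real.log ‖z‖| := by
  cases b <;> simp [endChart, Real.log_inv]

theorem isOpen_endChart_image (b : Bool) {s : Set ℂ} (hs : IsOpen s) (h0 : s ⊆ {0}ᶜ) :
    IsOpen (endChart b '' s) := by
  have h1 : endChart b '' s = {0}ᶜ ∩ endChart b ⁻¹' s := by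
    ext z
    constructor
    · rintro ⟨x, hx, rfl⟩
      exact ⟨endChart_ne_zero b (h0 hx), by rwa [mem_preimage, endChart_endChart]⟩
    · rintro ⟨-, hz⟩
      exact ⟨_, hz, endChart_endChart b z⟩
  rw [h1]
  exact (continuousOn_endChart b).isOpen_inter_preimage isOpen_compl_singleton hs

namespace IsTranscendentalSelfMapCStar

variable {f : ℂ → ℂ}

theorem conj_endChart (hf : IsTranscendentalSelfMapCStar f) (b b' : Bool) :
    IsTranscendentalSelfMapCStar (fun z => endChart b' (f (endChart b z))) := by
  cases b <;> cases b'
  · exact hf.comp_inv.inv_apply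
  · exact hf.comp_inv
  · exact hf.inv_apply
  · exact hf

/-- The boundary of a large bounded neighbourhood of `0` is mapped over the boundary of a
bounded neighbourhood of twice the size. -/
theorem eventually_exists_frontier_subset_image (hf : IsTranscendentalSelfMapCStar f) :
    ∀ᶠ R : ℝ in atTop, ∀ U, IsBoundedOpenNhd R U →
      ∃ U', IsBoundedOpenNhd (2 * R) U' ∧ frontier U' ⊆ f '' frontier U := by
  have hsphere : Metric.sphere (0 : ℂ) 1 ⊆ {0}ᶜ := by
    intro z hz h
    rw [mem_singleton_iff] at h
    simp [h] at hz
  obtain ⟨M, hM⟩ := (isCompact_sphere (0 : ℂ) 1).exists_bound_of_continuousOn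
    (hf.differentiableOn.continuousOn.mono hsphere)
  filter_upwards [hf.eventually_annulus_subset_image, eventually_gt_atTop M,
    eventually_ge_atTop 1] with R hR hRM hR1 U hU
  set Q := closure U \ Metric.ball 0 1 with hQdef
  set V := U \ Metric.closedBall 0 1 with hVdef
  have hQ : IsCompact Q := hU.2.1.isCompact_closure.diff Metric.isOpen_ball
  have hQ0 : Q ⊆ {0}ᶜ := by
    rintro z ⟨-, hz⟩ h
    rw [mem_singleton_iff] at h
    exact hz (by simp [h])
  have hVQ : V ⊆ Q := sdiff_subset_sdiff subset_closure Metric.ball_subset_closedBall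
  have hfQ : ContinuousOn f Q := hf.differentiableOn.continuousOn.mono hQ0
  have hV : IsOpen (f '' V) :=
    hf.isOpen_image (hU.1.sdiff Metric.isClosed_closedBall) (hVQ.trans hQ0)
  have hS : Metric.sphere 0 (2 * R) ⊆ f '' V := by
    intro w hw
    rw [mem_sphere_zero_iff_norm] at hw
    have hw0 : w ≠ 0 := norm_pos_iff.1 (by linarith)
    obtain ⟨z, h1, h2, rfl⟩ := hR w hw0 (by
      rw [hw, abs_of_nonneg (Real.log_nonneg (by linarith))])
    exact ⟨z, ⟨hU.2.2 (by simpa using h2.le), by simpa using h1⟩, rfl⟩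
  refine ⟨_, isBoundedOpenNhd_image_union_ball hQ hfQ hVQ hV hS, fun x hx => ?_⟩
  obtain ⟨⟨q, ⟨⟨hqU, hq1⟩, hqV⟩, rfl⟩, hxS⟩ :=
    frontier_image_union_ball_subset hQ hfQ hVQ hV hS hx
  refine ⟨q, ?_, rfl⟩
  rw [hU.1.frontier_eq]
  refine ⟨hqU, fun hq => hxS ?_⟩
  have hq2 : ‖q‖ = 1 := by
    have h1 : 1 ≤ ‖q‖ := by simpa using hq1
    have h2 : q ∈ Metric.closedBall (0 : ℂ) 1 := by
      by_contra h
      exact hqV ⟨hq, h⟩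
    exact le_antisymm (by simpa using h2) h1
  have := hM q (by simpa using hq2)
  rw [mem_closedBall_zero_iff]
  linarith

/-- The boundary of `G` contains a point whose orbit escapes with itinerary exactly `e` from some
time on. -/
theorem exists_mem_frontier_itinerary (hf : IsTranscendentalSelfMapCStar f) {G : Set ℂ}
    (hG : IsOpen G) (hGbdd : BoundedInCStar G) (hGJ : (G ∩ JuliaSet f).Nonempty)
    (e : ℕ → Bool) :
    ∃ z ∈ boundaryInCStar G, z ∈ escapingSet f ∧
      ∃ l : ℕ, ∀ n : ℕ, (1 < ‖f^[n + l] z‖ ↔ e n = true) := by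
  obtain ⟨r₁, r₂, hr₁, -, hGr⟩ := hGbdd
  have hclG : closure G ⊆ {z : ℂ | r₁ ≤ ‖z‖ ∧ ‖z‖ ≤ r₂} :=
    closure_minimal hGr ((isClosed_le continuous_const continuous_norm).inter
      (isClosed_le continuous_norm continuous_const))
  have hcl0 : closure G ⊆ {0}ᶜ := by
    intro z hz h
    rw [mem_singleton_iff] at h
    have := (hclG hz).1
    rw [h, norm_zero] at this
    linarith
  have hGcomp : IsCompact (closure G) :=
    (isCompact_closedBall (0 : ℂ) r₂).of_isClosed_subset isClosed_closure
      fun z hz => by simpa using (hclG hz).2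
  have hev : ∀ᶠ R : ℝ in atTop, ∀ b b' : Bool, ∀ U, IsBoundedOpenNhd R U →
      ∃ U', IsBoundedOpenNhd (2 * R) U' ∧
        frontier U' ⊆ (fun z => endChart b' (f (endChart b z))) '' frontier U :=
    eventually_all.2 fun b => eventually_all.2 fun b' =>
      (hf.conj_endChart b b').eventually_exists_frontier_subset_image
  obtain ⟨R₀, hR₀⟩ := eventually_atTop.1 hev
  set R := max R₀ 1 with hRdef
  have hR1 : 1 ≤ R := le_max_right _ _
  have hR0 : 0 < R := by linarith
  have hRpow : ∀ k : ℕ, R ≤ 2 ^ k * R := fun k =>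
    le_mul_of_one_le_left hR0.le (one_le_pow₀ (by norm_num))
  obtain ⟨n, hn⟩ := hf.exists_annulus_subset_iterate_image hG (subset_closure.trans hcl0) hGJ
    (Real.log R)
  obtain ⟨U₀, hU₀, hU₀f⟩ : ∃ U₀, IsBoundedOpenNhd R U₀ ∧
      frontier U₀ ⊆ (fun z => endChart (e 0) (f^[n] z)) '' frontier G := by
    have hit0 : f^[n] '' G ⊆ {0}ᶜ := by
      rintro _ ⟨z, hz, rfl⟩
      exact hf.iterate_ne_zero n (hcl0 (subset_closure hz))
    have hcont : ContinuousOn (fun z => endChart (e 0) (f^[n] z)) (closure G) :=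
      (continuousOn_endChart (e 0)).comp
        ((hf.iterate_differentiableOn n).continuousOn.mono hcl0)
        (fun z hz => hf.iterate_ne_zero n (hcl0 hz))
    have hopen : IsOpen ((fun z => endChart (e 0) (f^[n] z)) '' G) := by
      have := isOpen_endChart_image (e 0)
        (hf.isOpen_iterate_image n hG (subset_closure.trans hcl0)) hit0
      rwa [image_image] at this
    have hS : Metric.sphere 0 R ⊆ (fun z => endChart (e 0) (f^[n] z)) '' G := by
      intro w hw
      rw [mem_sphere_zero_iff_norm] at hw
      have hw0 : w ≠ 0 := norm_pos_iff.1 (by linarith)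
      obtain ⟨z, hz, hzw⟩ := hn (endChart (e 0) w) (endChart_ne_zero _ hw0) (by
        rw [abs_log_norm_endChart, hw, abs_of_nonneg (Real.log_nonneg hR1)])
      exact ⟨z, hz, by simp only [hzw, endChart_endChart]⟩
    refine ⟨_, isBoundedOpenNhd_image_union_ball hGcomp hcont subset_closure hopen hS, ?_⟩
    rw [hG.frontier_eq]
    exact (frontier_image_union_ball_subset hGcomp hcont subset_closure hopen hS).trans
      sdiff_subset
  have hstep : ∀ k : ℕ, ∀ U, IsBoundedOpenNhd (2 ^ k * R) U →
      ∃ U', IsBoundedOpenNhd (2 ^ (k + 1) * R) U' ∧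
        frontier U' ⊆ (fun z => endChart (e (k + 1)) (f (endChart (e k) z))) '' frontier U := by
    intro k U hU
    have := hR₀ (2 ^ k * R) ((le_max_left _ _).trans (hRpow k)) (e k) (e (k + 1)) U hU
    rwa [show 2 * (2 ^ k * R) = 2 ^ (k + 1) * R by ring] at this
  choose! next hnext hnextf using hstep
  set U : ℕ → Set ℂ := fun k => Nat.rec U₀ (fun k V => next k V) k with hUdef
  have hU : ∀ k, IsBoundedOpenNhd (2 ^ k * R) (U k) := by
    intro k
    induction k with
    | zero => simpa [hUdef] using hU₀
    | succ k ih => exact hnext k _ ih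
  have hUf : ∀ k, frontier (U (k + 1)) ⊆
      (fun z => endChart (e (k + 1)) (f (endChart (e k) z))) '' frontier (U k) :=
    fun k => hnextf k _ (hU k)
  have hlt : ∀ k, ∀ z ∈ frontier (U k), 2 ^ k * R < ‖z‖ := fun k z hz =>
    (hU k).lt_norm_of_mem_frontier hz
  have hfr0 : ∀ k, frontier (U k) ⊆ {0}ᶜ := by
    intro k z hz h
    rw [mem_singleton_iff] at h
    have := hlt k z hz
    rw [h, norm_zero] at this
    linarith [hRpow k]
  set E : ℕ → Set ℂ := fun k => endChart (e k) '' frontier (U k) with hEdef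
  have hE0 : E 0 ⊆ {0}ᶜ := by
    rintro _ ⟨z, hz, rfl⟩
    exact endChart_ne_zero _ (hfr0 0 hz)
  obtain ⟨y, hy, hyE⟩ := exists_forall_iterate_mem (f := f) (E := E)
    (fun k => (hU k).isCompact_frontier.image_of_continuousOn
      ((continuousOn_endChart _).mono (hfr0 k)))
    (fun k => ((hU k).frontier_nonempty (hR0.le.trans (hRpow k))).image _) hE0
    (fun k => (hf.iterate_differentiableOn k).continuousOn)
    (by
      rintro k _ ⟨x, hx, rfl⟩
      obtain ⟨x', hx', rfl⟩ := hUf k hx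
      exact ⟨_, ⟨x', hx', rfl⟩, (endChart_endChart _ _).symm⟩)
  obtain ⟨x, hx, rfl⟩ := hy
  obtain ⟨z, hz, rfl⟩ := hU₀f hx
  simp only [endChart_endChart, ← iterate_add_apply] at hyE
  have hz0 : z ∉ ({0} : Set ℂ) := hcl0 (frontier_subset_closure hz)
  have hdich : ∀ k, (e k = true ∧ 2 ^ k * R < ‖f^[k + n] z‖) ∨
      (e k = false ∧ ‖f^[k + n] z‖ < (2 ^ k * R)⁻¹) := by
    intro k
    obtain ⟨x, hx, hxz⟩ := hyE k
    rw [← hxz]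
    cases hek : e k
    · refine Or.inr ⟨rfl, ?_⟩
      simp only [endChart, norm_inv]
      exact inv_strictAnti₀ (by positivity) (hlt k x hx)
    · exact Or.inl ⟨rfl, hlt k x hx⟩
  refine ⟨z, ⟨hz, hz0⟩, ⟨hz0, fun ε hε => ?_⟩, n, fun k => ?_⟩
  · obtain ⟨N, hN⟩ := pow_unbounded_of_one_lt ε⁻¹ (by norm_num : (1 : ℝ) < 2)
    refine ⟨N + n, fun k hk => ?_⟩
    obtain ⟨j, rfl⟩ : ∃ j, k = j + n := ⟨k - n, by omega⟩
    have hj : ε⁻¹ < 2 ^ j * R := by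
      calc ε⁻¹ < 2 ^ N := hN
        _ ≤ 2 ^ j := pow_le_pow_right₀ (by norm_num) (by omega)
        _ ≤ 2 ^ j * R := le_mul_of_one_le_right (by positivity) hR1
    rcases hdich j with ⟨-, h⟩ | ⟨-, h⟩
    · right
      rw [one_div]
      exact hj.trans h
    · left
      exact h.trans (inv_lt_of_inv_lt₀ hε hj)
  · rcases hdich k with ⟨he, h⟩ | ⟨he, h⟩
    · simp only [he, iff_true]
      linarith [hRpow k]
    · simp only [he, Bool.false_eq_true, iff_false, not_lt]
      exact h.le.trans (inv_le_one_of_one_le₀ (hR1.trans (hRpow k)))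

end IsTranscendentalSelfMapCStar

/-- If `G ⊆ ℂ*` is a domain, bounded in `ℂ*`, meeting `J(f)`, then
`∂G ∩ I_e(f) ≠ ∅` for every `e ∈ {0,∞}^ℕ`; in particular `∂G ∩ I(f)` is uncountable
(the boundary `∂G` is taken in `ℂ*`). -/
theorem boundary_meets_every_littleEscapingSet (f : ℂ → ℂ)
    (hf : IsTranscendentalSelfMapCStar f) (G : Set ℂ)
    (hGopen : IsOpen G) (hGconn : IsConnected G) (hGsub : G ⊆ {z : ℂ | z ≠ 0})
    (hGbdd : BoundedInCStar G) (hGJ : (G ∩ JuliaSet f).Nonempty) :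
    (∀ e : ℕ → Bool, (boundaryInCStar G ∩ littleEscapingSet f e).Nonempty) ∧
    ¬ (boundaryInCStar G ∩ escapingSet f).Countable := by
  have key := hf.exists_mem_frontier_itinerary hGopen hGbdd hGJ
  refine ⟨fun e => ?_, fun hcount => ?_⟩
  · obtain ⟨z, hz, hesc, l, hl⟩ := key e
    exact ⟨z, hz, hesc, l, 0, hl⟩
  · choose z hz hesc l hl using key
    have := hcount.to_subtype
    have hinj : Injective (fun e : ℕ → Bool =>
        ((⟨z e, hz e, hesc e⟩ : ↥(boundaryInCStar G ∩ escapingSet f)), l e)) := by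
      intro e e' h
      have hze : z e = z e' := congrArg Subtype.val (Prod.ext_iff.1 h).1
      have hle : l e = l e' := (Prod.ext_iff.1 h).2
      funext n
      have h1 := hl e n
      rw [hze, hle, hl e' n] at h1
      exact Bool.eq_iff_iff.2 h1.symm
    have := hinj.countable
    obtain ⟨F, hF⟩ := exists_surjective_nat (ℕ → Bool)
    obtain ⟨n, hn⟩ := hF fun n => !F n n
    simpa using congrFun hn n
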